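/- arXiv:2301.05076 — 11 statements merged into one kernel-verified Lean document; each statement's English description precedes it below -/
import Mathlib

section
/- Let μ > 0 and let γ₁,…,γ₆ > 0 satisfy the constant-vertex-weight conditions γ₁+γ₄ = γ₂+γ₅, γ₃+γ₆ = γ₂+γ₅, γ₁+γ₃+γ₄+γ₆ = μ. Then the following are equivalent: (i) there exists a real number E such that det(E·Id − Δ^θ_γ) = 0 for every θ ∈ ℝ² (a flat band exists); (ii) there exist α, β > 0 with 2(α+β) = μ such that γ₂ = γ₄ = γ₆ = α and γ₁ = γ₃ = γ₅ = β. -/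
open Matrix

/-- The Kagome Floquet adjacency matrix `Π^θ_γ`. -/
noncomputable def KPi (g1 g2 g3 g4 g5 g6 θ1 θ2 : ℝ) : Matrix (Fin 3) (Fin 3) ℂ :=
  let w : ℂ := Complex.exp (Complex.I * θ1)
  let z : ℂ := Complex.exp (Complex.I * θ2)
  !![0, (g3 : ℂ) + w * g6, w * g4 + z * g1;
     (g3 : ℂ) + (starRingEnd ℂ) w * g6, 0, (g2 : ℂ) + z * g5;
     (starRingEnd ℂ) w * g4 + (starRingEnd ℂ) z * g1, (g2 : ℂ) + (starRingEnd ℂ) z * g5, 0]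

/-- The Kagome Floquet Laplacian `Δ^θ_γ = Id − (1/μ) Π^θ_γ`. -/
noncomputable def KDelta (g1 g2 g3 g4 g5 g6 μ θ1 θ2 : ℝ) : Matrix (Fin 3) (Fin 3) ℂ :=
  1 - (μ : ℂ)⁻¹ • KPi g1 g2 g3 g4 g5 g6 θ1 θ2

/-- The characteristic polynomial of the Floquet Laplacian as a trigonometric polynomial, where
`μ * (E - 1)` is the spectral parameter of `-Π^θ_γ`. -/
theorem mu_cube_mul_det_sub_KDelta (g1 g2 g3 g4 g5 g6 μ E θ1 θ2 : ℝ) (hμ : μ ≠ 0) :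
    (μ : ℂ) ^ 3 * Matrix.det ((E : ℂ) • (1 : Matrix (Fin 3) (Fin 3) ℂ)
      - KDelta g1 g2 g3 g4 g5 g6 μ θ1 θ2) =
    (((μ * (E - 1)) ^ 3
      - μ * (E - 1) * (g1 ^ 2 + g2 ^ 2 + g3 ^ 2 + g4 ^ 2 + g5 ^ 2 + g6 ^ 2)
      + 2 * (g1 * g3 * g5 + g2 * g4 * g6)
      + 2 * (g2 * g3 * g4 + g1 * g5 * g6 - μ * (E - 1) * (g3 * g6)) * Real.cos θ1
      + 2 * (g1 * g2 * g3 + g4 * g5 * g6 - μ * (E - 1) * (g2 * g5)) * Real.cos θ2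
      + 2 * (g3 * g4 * g5 + g1 * g2 * g6 - μ * (E - 1) * (g1 * g4)) * Real.cos (θ1 - θ2) :
      ℝ) : ℂ) := by
  have hm : (μ : ℂ) * (μ : ℂ)⁻¹ = 1 := mul_inv_cancel₀ (Complex.ofReal_ne_zero.mpr hμ)
  have hconj (θ : ℝ) : (starRingEnd ℂ) (Complex.exp (Complex.I * θ)) =
      Complex.exp (-(Complex.I * θ)) := by
    rw [← Complex.exp_conj]
    simp
  have hunit (θ : ℝ) :
      Complex.exp (Complex.I * θ) * Complex.exp (-(Complex.I * θ)) = 1 := by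
    rw [← Complex.exp_add, add_neg_cancel, Complex.exp_zero]
  have hcos (θ : ℝ) : Complex.cos θ =
      (Complex.exp (Complex.I * θ) + Complex.exp (-(Complex.I * θ))) / 2 := by
    rw [Complex.cos]
    ring_nf
  have hsin (θ : ℝ) : Complex.sin θ =
      (Complex.exp (-(Complex.I * θ)) - Complex.exp (Complex.I * θ)) * Complex.I / 2 := by
    rw [Complex.sin]
    ring_nf
  have hw := hunit θ1
  have hz := hunit θ2
  simp only [KDelta, KPi, hconj]
  push_cast
  rw [Complex.cos_sub, hcos, hcos, hsin, hsin]
  generalize Complex.exp (Complex.I * θ1) = w at *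
  generalize Complex.exp (-(Complex.I * θ1)) = w' at *
  generalize Complex.exp (Complex.I * θ2) = z at *
  generalize Complex.exp (-(Complex.I * θ2)) = z' at *
  have key : (μ : ℂ) • ((E : ℂ) • 1 - (1 - (μ : ℂ)⁻¹ •
      !![0, (g3 : ℂ) + w * g6, w * g4 + z * g1; (g3 : ℂ) + w' * g6, 0, (g2 : ℂ) + z * g5;
        w' * g4 + z' * g1, (g2 : ℂ) + z' * g5, 0])) =
      !![(μ : ℂ) * (E - 1), (g3 : ℂ) + w * g6, w * g4 + z * g1;
        (g3 : ℂ) + w' * g6, (μ : ℂ) * (E - 1), (g2 : ℂ) + z * g5;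
        w' * g4 + z' * g1, (g2 : ℂ) + z' * g5, (μ : ℂ) * (E - 1)] := by
    ext i j
    fin_cases i <;> fin_cases j <;> simp [← mul_assoc, hm]
  rw [show (μ : ℂ) ^ 3 = μ ^ Fintype.card (Fin 3) by simp, ← Matrix.det_smul, key,
    Matrix.det_fin_three]
  simp only [Matrix.of_apply, Matrix.cons_val]
  linear_combination (-(μ * (E - 1)) * (g6 ^ 2 + g4 ^ 2 : ℂ) + 2 * g2 * g4 * g6
      + g4 * g5 * g6 * (z + z')) * hw
    + (-(μ * (E - 1)) * (g1 ^ 2 + g5 ^ 2 : ℂ) + 2 * g1 * g3 * g5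
      + g1 * g5 * g6 * (w + w')) * hz
    - (g3 * g4 * g5 + g1 * g2 * g6 - μ * (E - 1) * (g1 * g4) : ℂ) * (w' - w) * (z' - z) / 2
      * Complex.I_sq

/-- Vanishing of the nonconstant Fourier coefficients forces two of the weights to agree or
balances them. -/
theorem eq_or_balanced {p P q Q r R x : ℝ} (hq : p + P = q + Q)
    (hpx : x * (p * P) = q * r * P + Q * R * p)
    (hqx : x * (q * Q) = p * r * Q + P * R * q) :
    p = q ∨ r * P * Q * (p + q) = R * p * q * (P + Q) := by
  have h : (p - q) * (r * P * Q * (p + q) - R * p * q * (P + Q)) = 0 := by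
    obtain rfl : Q = p + P - q := by linarith
    linear_combination (q * (p + P - q)) * hpx - (p * P) * hqx
  rcases mul_eq_zero.mp h with h | h
  · exact .inl (sub_eq_zero.mp h)
  · exact .inr (sub_eq_zero.mp h)

theorem eq_of_balanced {p P q Q r R : ℝ} (hp : 0 < p) (hP : 0 < P) (hq : 0 < q) (hQ : 0 < Q)
    (hr : 0 < r) (hR : 0 < R) (hpq : p + P = q + Q) (hpr : p + P = r + R)
    (h₁ : r * P * Q * (p + q) = R * p * q * (P + Q))
    (h₂ : q * P * R * (p + r) = Q * p * r * (P + R)) : q = r := by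
  have h : p * P * ((r - q) * ((p * (q + r) + q * r) * (Q ^ 2 * (P + R))
      + (q ^ 2 * (p + r)) * (P * (Q + R) + Q * R))) = 0 := by
    obtain rfl : Q = p + P - q := by linarith
    obtain rfl : R = p + P - r := by linarith
    linear_combination ((p + P - q) * p * r * (P + (p + P - r))) * h₁
      - ((p + P - r) * p * q * (P + (p + P - q))) * h₂
  have hpos : 0 < (p * (q + r) + q * r) * (Q ^ 2 * (P + R))
      + (q ^ 2 * (p + r)) * (P * (Q + R) + Q * R) := by positivity
  have := (mul_eq_zero.mp ((mul_eq_zero.mp h).resolve_left (by positivity))).resolve_right hpos.ne'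
  linarith

theorem eq_of_pair_eq {p P r R x : ℝ} (hp : 0 < p) (hP : 0 < P) (hpr : p + P = r + R)
    (hpx : x * (p * P) = p * r * P + P * R * p)
    (hrx : x * (r * R) = p * p * R + P * P * r) : p = r := by
  have hx : x = r + R := by
    have : x * (p * P) = (r + R) * (p * P) := by linear_combination hpx
    exact mul_right_cancel₀ (by positivity) this
  have h : (p + P) * (p - r) ^ 2 = 0 := by
    obtain rfl : R = p + P - r := by linarith
    subst hx
    linear_combination -hrx
  have := pow_eq_zero_iff two_ne_zero |>.mp ((mul_eq_zero.mp h).resolve_left (by positivity))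
  linarith

/-- If the nonconstant Fourier coefficients vanish, each triangle has constant weights. -/
theorem all_eq_of_fourier_coeff {p P q Q r R x : ℝ} (hp : 0 < p) (hP : 0 < P) (hq : 0 < q)
    (hQ : 0 < Q) (hr : 0 < r) (hR : 0 < R) (hpq : p + P = q + Q) (hpr : p + P = r + R)
    (hpx : x * (p * P) = q * r * P + Q * R * p)
    (hqx : x * (q * Q) = p * r * Q + P * R * q)
    (hrx : x * (r * R) = p * q * R + P * Q * r) : p = q ∧ p = r := by
  have key : p = q ∨ p = r ∨ q = r := by
    rcases eq_or_balanced hpq hpx hqx with h | h₁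
    · exact .inl h
    rcases eq_or_balanced (r := q) (R := Q) hpr (by linear_combination hpx) hrx with h | h₂
    · exact .inr (.inl h)
    exact .inr (.inr (eq_of_balanced hp hP hq hQ hr hR hpq hpr h₁ h₂))
  rcases key with rfl | rfl | rfl
  · obtain rfl : P = Q := by linarith
    exact ⟨rfl, eq_of_pair_eq hp hP hpr hpx hrx⟩
  · obtain rfl : P = R := by linarith
    exact ⟨eq_of_pair_eq hp hP hpq (x := x) (by linear_combination hpx)
      (by linear_combination hqx), rfl⟩
  · obtain rfl : Q = R := by linarith
    have := eq_of_pair_eq hq hQ hpq.symm (x := x) (by linear_combination hqx)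
      (by linear_combination hpx)
    exact ⟨this.symm, this.symm⟩

/-- A flat band exists for the constant-vertex-weight Kagome Laplacian iff the weights
are monomeric. -/
theorem kagome_flat_band_iff_monomeric
    (μ g1 g2 g3 g4 g5 g6 : ℝ) (hμ : 0 < μ)
    (h1 : 0 < g1) (h2 : 0 < g2) (h3 : 0 < g3) (h4 : 0 < g4) (h5 : 0 < g5) (h6 : 0 < g6)
    (ha : g1 + g4 = g2 + g5) (hb : g3 + g6 = g2 + g5) (hc : g1 + g3 + g4 + g6 = μ) :
    (∃ E : ℝ, ∀ θ1 θ2 : ℝ,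
        Matrix.det ((E : ℂ) • (1 : Matrix (Fin 3) (Fin 3) ℂ)
          - KDelta g1 g2 g3 g4 g5 g6 μ θ1 θ2) = 0)
    ↔ (∃ α β : ℝ, 0 < α ∧ 0 < β ∧ 2 * (α + β) = μ ∧
        g2 = α ∧ g4 = α ∧ g6 = α ∧ g1 = β ∧ g3 = β ∧ g5 = β) := by
  constructor
  · rintro ⟨E, hE⟩
    have hF (θ1 θ2 : ℝ) := (mu_cube_mul_det_sub_KDelta g1 g2 g3 g4 g5 g6 μ E θ1 θ2 hμ.ne').symm
    simp only [hE, mul_zero, Complex.ofReal_eq_zero] at hF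
    have h00 := hF 0 0
    have h10 := hF Real.pi 0
    have h01 := hF 0 Real.pi
    have h11 := hF Real.pi Real.pi
    simp only [sub_zero, zero_sub, sub_self, Real.cos_neg, Real.cos_zero, Real.cos_pi]
      at h00 h10 h01 h11
    obtain ⟨h13, h15⟩ := all_eq_of_fourier_coeff (x := μ * (E - 1)) h1 h4 h3 h6 h5 h2
      (by linarith) (by linarith) (by linarith) (by linarith) (by linarith)
    exact ⟨g2, g1, h2, h1, by linarith, rfl, by linarith, by linarith, rfl, h13.symm, h15.symm⟩
  · rintro ⟨α, β, -, -, rfl, rfl, rfl, rfl, rfl, rfl, rfl⟩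
    refine ⟨3 / 2, fun θ1 θ2 => ?_⟩
    have h := mu_cube_mul_det_sub_KDelta g5 g6 g5 g6 g5 g6 (2 * (g6 + g5)) (3 / 2) θ1 θ2 hμ.ne'
    refine (mul_eq_zero.mp (h.trans (Complex.ofReal_eq_zero.mpr ?_))).resolve_left
      (pow_ne_zero _ (Complex.ofReal_ne_zero.mpr hμ.ne'))
    ring
end

section
/- Let γ₁,…,γ₆ > 0 and λ ∈ ℝ. Then det(λ·Id − Π^θ_γ) = 0 for every θ ∈ ℝ² if and only if the following four conditions hold: λγ₆γ₃ + γ₃γ₂γ₄ + γ₆γ₅γ₁ = 0, λγ₅γ₂ + γ₆γ₅γ₄ + γ₁γ₃γ₂ = 0, λγ₁γ₄ + γ₃γ₅γ₄ + γ₆γ₂γ₁ = 0, and −λ³ + λ(γ₁²+γ₂²+γ₃²+γ₄²+γ₅²+γ₆²) + 2(γ₄γ₆γ₂ + γ₃γ₅γ₁) = 0. -/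
open Matrix

/-- The characteristic polynomial of the Kagome Floquet matrix as a trigonometric polynomial. -/
theorem det_smul_one_sub_KPi (g1 g2 g3 g4 g5 g6 lam θ1 θ2 : ℝ) :
    Matrix.det ((lam : ℂ) • (1 : Matrix (Fin 3) (Fin 3) ℂ) - KPi g1 g2 g3 g4 g5 g6 θ1 θ2) =
      ((-((- lam ^ 3 + lam * (g1 ^ 2 + g2 ^ 2 + g3 ^ 2 + g4 ^ 2 + g5 ^ 2 + g6 ^ 2)
          + 2 * (g4 * g6 * g2 + g3 * g5 * g1))
        + 2 * Real.cos θ1 * (lam * g6 * g3 + g3 * g2 * g4 + g6 * g5 * g1)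
        + 2 * Real.cos θ2 * (lam * g5 * g2 + g6 * g5 * g4 + g1 * g3 * g2)
        + 2 * Real.cos (θ1 - θ2) * (lam * g1 * g4 + g3 * g5 * g4 + g6 * g2 * g1)) : ℝ) : ℂ) := by
  have exp_eq (θ : ℝ) : Complex.exp (Complex.I * θ) = ⟨Real.cos θ, Real.sin θ⟩ := by
    rw [mul_comm]
    apply Complex.ext <;> simp [Complex.exp_ofReal_mul_I_re, Complex.exp_ofReal_mul_I_im]
  have e1 := Real.sin_sq_add_cos_sq θ1
  have e2 := Real.sin_sq_add_cos_sq θ2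
  rw [Matrix.det_fin_three, Real.cos_sub]
  generalize hc1 : Real.cos θ1 = c1 at *
  generalize hs1 : Real.sin θ1 = s1 at *
  generalize hc2 : Real.cos θ2 = c2 at *
  generalize hs2 : Real.sin θ2 = s2 at *
  apply Complex.ext
  · simp [KPi, exp_eq, hc1, hs1, hc2, hs2, pow_succ]
    clear exp_eq
    grind
  · simp [KPi, exp_eq, hc1, hs1, hc2, hs2, pow_succ]
    grind

/-- `λ` is a `θ`-independent eigenvalue of the Kagome Floquet adjacency matrix iff the four
coefficient conditions hold. -/
theorem kagome_theta_independent_eigenvalue_iff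
    (g1 g2 g3 g4 g5 g6 : ℝ)
    (h1 : 0 < g1) (h2 : 0 < g2) (h3 : 0 < g3) (h4 : 0 < g4) (h5 : 0 < g5) (h6 : 0 < g6)
    (lam : ℝ) :
    (∀ θ1 θ2 : ℝ,
      Matrix.det ((lam : ℂ) • (1 : Matrix (Fin 3) (Fin 3) ℂ)
        - KPi g1 g2 g3 g4 g5 g6 θ1 θ2) = 0)
    ↔ (lam * g6 * g3 + g3 * g2 * g4 + g6 * g5 * g1 = 0 ∧
       lam * g5 * g2 + g6 * g5 * g4 + g1 * g3 * g2 = 0 ∧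
       lam * g1 * g4 + g3 * g5 * g4 + g6 * g2 * g1 = 0 ∧
       - lam ^ 3 + lam * (g1 ^ 2 + g2 ^ 2 + g3 ^ 2 + g4 ^ 2 + g5 ^ 2 + g6 ^ 2)
          + 2 * (g4 * g6 * g2 + g3 * g5 * g1) = 0) := by
  simp only [det_smul_one_sub_KPi, Complex.ofReal_eq_zero]
  constructor
  · intro h
    have h00 := h 0 0
    have hπ0 := h Real.pi 0
    have h0π := h 0 Real.pi
    have hππ := h Real.pi Real.pi
    simp only [sub_self, sub_zero, zero_sub, Real.cos_neg, Real.cos_zero, Real.cos_pi]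
      at h00 hπ0 h0π hππ
    refine ⟨?_, ?_, ?_, ?_⟩ <;> linarith
  · rintro ⟨hA, hB, hC, hD⟩ θ1 θ2
    simp only [hA, hB, hC, hD, mul_zero, add_zero, neg_zero]
end

section
/- Let γ₁,…,γ₆ > 0 and λ ∈ ℝ. If det(λ·Id − Π^θ_γ) = 0 for every θ ∈ ℝ², then λ < 0. -/
open Matrix

/-- The characteristic determinant at a point where `w = s` and `z = t` are real. -/
theorem det_sub_KPi_of_exp_eq_ofReal (g1 g2 g3 g4 g5 g6 lam θ1 θ2 s t : ℝ)
    (hs : Complex.exp (Complex.I * θ1) = s) (ht : Complex.exp (Complex.I * θ2) = t) :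
    Matrix.det ((lam : ℂ) • (1 : Matrix (Fin 3) (Fin 3) ℂ) - KPi g1 g2 g3 g4 g5 g6 θ1 θ2) =
      ((lam ^ 3 - lam * ((g3 + s * g6) ^ 2 + (s * g4 + t * g1) ^ 2 + (g2 + t * g5) ^ 2)
        - 2 * (g3 + s * g6) * (s * g4 + t * g1) * (g2 + t * g5) : ℝ) : ℂ) := by
  simp only [KPi, hs, ht, Complex.conj_ofReal, Matrix.det_fin_three]
  simp
  ring

/-- Any `θ`-independent eigenvalue of the Kagome Floquet adjacency matrix is negative. -/
theorem kagome_flat_band_negative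
    (g1 g2 g3 g4 g5 g6 : ℝ)
    (h1 : 0 < g1) (h2 : 0 < g2) (h3 : 0 < g3) (h4 : 0 < g4) (h5 : 0 < g5) (h6 : 0 < g6)
    (lam : ℝ)
    (h : ∀ θ1 θ2 : ℝ,
      Matrix.det ((lam : ℂ) • (1 : Matrix (Fin 3) (Fin 3) ℂ)
        - KPi g1 g2 g3 g4 g5 g6 θ1 θ2) = 0) :
    lam < 0 := by
  have exp_zero : Complex.exp (Complex.I * (0 : ℝ)) = (1 : ℝ) := by simp
  have exp_pi : Complex.exp (Complex.I * (Real.pi : ℝ)) = (-1 : ℝ) := by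
    rw [mul_comm, Complex.exp_pi_mul_I]; simp
  have charpoly_zero : ∀ θ1 θ2 s t : ℝ, Complex.exp (Complex.I * θ1) = s →
      Complex.exp (Complex.I * θ2) = t →
      lam ^ 3 - lam * ((g3 + s * g6) ^ 2 + (s * g4 + t * g1) ^ 2 + (g2 + t * g5) ^ 2)
        - 2 * (g3 + s * g6) * (s * g4 + t * g1) * (g2 + t * g5) = 0 := by
    intro θ1 θ2 s t hs ht
    exact Complex.ofReal_eq_zero.mp
      ((det_sub_KPi_of_exp_eq_ofReal g1 g2 g3 g4 g5 g6 lam θ1 θ2 s t hs ht).symm.trans (h θ1 θ2))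
  -- These four values isolate the coefficient of `cos θ₁`.
  have hpp := charpoly_zero 0 0 1 1 exp_zero exp_zero
  have hmp := charpoly_zero Real.pi 0 (-1) 1 exp_pi exp_zero
  have hpm := charpoly_zero 0 Real.pi 1 (-1) exp_zero exp_pi
  have hmm := charpoly_zero Real.pi Real.pi (-1) (-1) exp_pi exp_pi
  have cos_coeff : lam * (g3 * g6) = -(g2 * g3 * g4 + g1 * g5 * g6) := by
    linear_combination (-hpp + hmp - hpm + hmm) / 8
  have : lam * (g3 * g6) < 0 := by
    rw [cos_coeff]
    exact neg_lt_zero.mpr (by positivity)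
  exact neg_of_mul_neg_left this (by positivity)
end

section
/- Let μ > 0 and α, β > 0 with 2(α+β) = μ, and consider the monomeric Kagome edge weights γ₂ = γ₄ = γ₆ = α, γ₁ = γ₃ = γ₅ = β. Then the set {λ ∈ ℝ : there exists θ ∈ ℝ² with det(λ·Id − Δ^θ_γ) = 0} equals the union of intervals [0, 3/4 − |3α/μ − 3/4|] ∪ [3/4 + |3α/μ − 3/4|, 3/2]. Moreover, for every θ ∈ ℝ², 3/2 is an eigenvalue of Δ^θ_γ (a flat band at 3/2). -/
open Matrix

/-- The sum of cosines through which the monomeric Kagome dispersion relation depends on `θ`. -/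
noncomputable def cosSum (θ1 θ2 : ℝ) : ℝ :=
  Real.cos θ1 + Real.cos θ2 + Real.cos (θ1 - θ2)

theorem cosSum_le_three (θ1 θ2 : ℝ) : cosSum θ1 θ2 ≤ 3 := by
  unfold cosSum
  linarith [Real.cos_le_one θ1, Real.cos_le_one θ2, Real.cos_le_one (θ1 - θ2)]

theorem neg_three_halves_le_cosSum (θ1 θ2 : ℝ) : -(3 / 2) ≤ cosSum θ1 θ2 := by
  unfold cosSum
  rw [Real.cos_sub]
  nlinarith [sq_nonneg (1 + Real.cos θ1 + Real.cos θ2), sq_nonneg (Real.sin θ1 + Real.sin θ2),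
    Real.sin_sq_add_cos_sq θ1, Real.sin_sq_add_cos_sq θ2]

theorem exists_cosSum_eq {k : ℝ} (h₁ : -(3 / 2) ≤ k) (h₂ : k ≤ 3) :
    ∃ θ1 θ2 : ℝ, cosSum θ1 θ2 = k := by
  have hr := Real.sq_sqrt (show 0 ≤ 3 + 2 * k by linarith)
  have hr0 := Real.sqrt_nonneg (3 + 2 * k)
  set r := √(3 + 2 * k)
  have hr3 : r ≤ 3 := by nlinarith
  refine ⟨Real.arccos ((r - 1) / 2), -Real.arccos ((r - 1) / 2), ?_⟩
  rw [cosSum, sub_neg_eq_add, ← two_mul, Real.cos_two_mul, Real.cos_neg,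
    Real.cos_arccos (by linarith) (by linarith)]
  linarith

theorem ofReal_cosSum (θ1 θ2 : ℝ) :
    ((cosSum θ1 θ2 : ℝ) : ℂ) =
      (Complex.exp (Complex.I * θ1) + (Complex.exp (Complex.I * θ1))⁻¹
        + Complex.exp (Complex.I * θ2) + (Complex.exp (Complex.I * θ2))⁻¹
        + Complex.exp (Complex.I * θ1) * (Complex.exp (Complex.I * θ2))⁻¹
        + (Complex.exp (Complex.I * θ1))⁻¹ * Complex.exp (Complex.I * θ2)) / 2 := by
  simp only [cosSum, Complex.ofReal_add, Complex.ofReal_cos, Complex.ofReal_sub, Complex.cos,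
    ← Complex.exp_neg, ← Complex.exp_add]
  ring_nf

/-- The characteristic polynomial of the monomeric Kagome Laplacian splits off the flat band. -/
theorem det_monomeric {μ α β : ℝ} (hμ : μ ≠ 0) (hab : 2 * (α + β) = μ) (lam θ1 θ2 : ℝ) :
    Matrix.det ((lam : ℂ) • (1 : Matrix (Fin 3) (Fin 3) ℂ) - KDelta β α β α β α μ θ1 θ2) =
      (((lam - 3 / 2) * ((lam - 3 / 4) ^ 2 - 9 / 16
        + 2 * α * β / μ ^ 2 * (3 - cosSum θ1 θ2)) : ℝ) : ℂ) := by
  have conj_exp (θ : ℝ) : (starRingEnd ℂ) (Complex.exp (Complex.I * θ)) =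
      (Complex.exp (Complex.I * θ))⁻¹ := by
    rw [← Complex.exp_conj, ← Complex.exp_neg]
    simp
  push_cast
  rw [ofReal_cosSum, KDelta, KPi]
  simp only [conj_exp]
  have hw := Complex.exp_ne_zero (Complex.I * θ1)
  have hz := Complex.exp_ne_zero (Complex.I * θ2)
  generalize Complex.exp (Complex.I * θ1) = w at *
  generalize Complex.exp (Complex.I * θ2) = z at *
  have hμ' : (μ : ℂ) ≠ 0 := by exact_mod_cast hμ
  have hβ : (β : ℂ) = μ / 2 - α := by
    rw [← hab]
    push_cast
    ring
  rw [Matrix.det_fin_three]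
  simp [hβ]
  field_simp
  ring

/-- The dispersion relation has a solution exactly when `lam` has the right distance to `3/4`. -/
theorem exists_dispersion_iff {μ α β : ℝ} (hμ : 0 < μ) (hα : 0 < α) (hβ : 0 < β)
    (hab : 2 * (α + β) = μ) (lam : ℝ) :
    (∃ θ1 θ2 : ℝ,
        (lam - 3 / 4) ^ 2 - 9 / 16 + 2 * α * β / μ ^ 2 * (3 - cosSum θ1 θ2) = 0) ↔
      |3 * α / μ - 3 / 4| ≤ |lam - 3 / 4| ∧ |lam - 3 / 4| ≤ 3 / 4 := by
  have hc : 0 < 2 * α * β / μ ^ 2 := by positivity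
  have hd : (3 * α / μ - 3 / 4) ^ 2 = 9 / 16 - 2 * α * β / μ ^ 2 * (9 / 2) := by
    obtain rfl : β = μ / 2 - α := by linarith
    field_simp
    ring
  rw [← sq_le_sq, hd, ← abs_of_pos (show (0 : ℝ) < 3 / 4 by norm_num), ← sq_le_sq,
    abs_of_pos (show (0 : ℝ) < 3 / 4 by norm_num)]
  generalize 2 * α * β / μ ^ 2 = c at *
  constructor
  · rintro ⟨θ1, θ2, h⟩
    have h₁ := mul_le_mul_of_nonneg_left (neg_three_halves_le_cosSum θ1 θ2) hc.le
    have h₂ := mul_le_mul_of_nonneg_left (cosSum_le_three θ1 θ2) hc.le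
    constructor <;> linarith
  · rintro ⟨h₁, h₂⟩
    obtain ⟨θ1, θ2, h⟩ := exists_cosSum_eq (k := 3 - (9 / 16 - (lam - 3 / 4) ^ 2) / c)
      (by
        have : (9 / 16 - (lam - 3 / 4) ^ 2) / c ≤ 9 / 2 := by
          rw [div_le_iff₀ hc]
          linarith
        linarith)
      (by
        have : 0 ≤ (9 / 16 - (lam - 3 / 4) ^ 2) / c := div_nonneg (by linarith) hc.le
        linarith)
    refine ⟨θ1, θ2, ?_⟩
    rw [h]
    field_simp
    ring

/-- The spectrum of the monomeric Kagome Laplacian, and its flat band at `3/2`. -/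
theorem kagome_monomeric_spectrum
    (μ α β : ℝ) (hμ : 0 < μ) (hα : 0 < α) (hβ : 0 < β) (hab : 2 * (α + β) = μ) :
    ({lam : ℝ | ∃ θ1 θ2 : ℝ,
        Matrix.det ((lam : ℂ) • (1 : Matrix (Fin 3) (Fin 3) ℂ)
          - KDelta β α β α β α μ θ1 θ2) = 0}
      = Set.Icc 0 (3/4 - |3 * α / μ - 3/4|) ∪ Set.Icc (3/4 + |3 * α / μ - 3/4|) (3/2))
    ∧ (∀ θ1 θ2 : ℝ,
        Matrix.det (((3/2 : ℝ) : ℂ) • (1 : Matrix (Fin 3) (Fin 3) ℂ)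
          - KDelta β α β α β α μ θ1 θ2) = 0) := by
  have hdet := det_monomeric hμ.ne' hab
  refine ⟨?_, fun θ1 θ2 => by rw [hdet]; simp⟩
  have hα' : α / μ ≤ 1 / 2 := by
    rw [div_le_iff₀ hμ]
    linarith
  have hd : |3 * α / μ - 3 / 4| ≤ 3 / 4 := by
    rw [mul_div_assoc, abs_le]
    constructor <;> linarith [div_pos hα hμ]
  ext lam
  simp only [Set.mem_ofPred_eq, Set.mem_union, Set.mem_Icc, hdet, Complex.ofReal_eq_zero,
    mul_eq_zero, exists_or, exists_const, exists_dispersion_iff hμ hα hβ hab]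
  rw [le_abs, abs_le (a := lam - 3 / 4)]
  constructor
  · rintro (h | ⟨h | h, h₁, h₂⟩)
    · right
      constructor <;> linarith
    · right
      constructor <;> linarith
    · left
      constructor <;> linarith
  · have hd0 := abs_nonneg (3 * α / μ - 3 / 4)
    rintro (⟨h₁, h₂⟩ | ⟨h₁, h₂⟩)
    · exact Or.inr ⟨Or.inr (by linarith), by linarith, by linarith⟩
    · exact Or.inr ⟨Or.inl (by linarith), by linarith, by linarith⟩
end

section
/- Let μ > 0 and α, β > 0 with 2(α+β) = μ, and consider the monomeric Kagome edge weights γ₂ = γ₄ = γ₆ = α, γ₁ = γ₃ = γ₅ = β. For θ = (θ₁,θ₂) ∈ ℝ² set F(θ) = cos(θ₁) + cos(θ₂) + cos(θ₁−θ₂). Then for every θ ∈ ℝ² the set of real eigenvalues of Δ^θ_γ (i.e., real roots λ of det(λ·Id − Δ^θ_γ) = 0) equals {3/2, 3/4 + (1/4)√(1 + 8(1 + (F(θ)−3)(2α/μ − 4α²/μ²))), 3/4 − (1/4)√(1 + 8(1 + (F(θ)−3)(2α/μ − 4α²/μ²)))}. -/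
open Matrix

/-- The characteristic polynomial of the monomeric Kagome Floquet Laplacian, factored. -/
theorem det_smul_one_sub_KDelta_monomeric {μ α β : ℝ} (hμ : μ ≠ 0) (hab : 2 * (α + β) = μ)
    (θ1 θ2 lam : ℝ) :
    Matrix.det ((lam : ℂ) • (1 : Matrix (Fin 3) (Fin 3) ℂ) - KDelta β α β α β α μ θ1 θ2) =
      (((lam - 3 / 2) * ((lam - 3 / 4) ^ 2 - 1 / 16 * (1 + 8 * (1 +
        ((Real.cos θ1 + Real.cos θ2 + Real.cos (θ1 - θ2)) - 3)
          * (2 * α / μ - 4 * α ^ 2 / μ ^ 2)))) : ℝ) : ℂ) := by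
  have hexp (t : ℝ) : Complex.exp (-(t * Complex.I)) = (Complex.exp (t * Complex.I))⁻¹ :=
    Complex.exp_neg _
  have hconj (t : ℝ) : (starRingEnd ℂ) (Complex.exp (t * Complex.I)) =
      (Complex.exp (t * Complex.I))⁻¹ := by
    rw [← Complex.exp_conj, ← hexp]
    simp
  have hcos (t : ℝ) : Complex.cos t =
      (Complex.exp (t * Complex.I) + (Complex.exp (t * Complex.I))⁻¹) / 2 := by
    rw [Complex.cos, neg_mul, hexp]
  have hdiff : Complex.exp (((θ1 - θ2 : ℝ) : ℂ) * Complex.I) =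
      Complex.exp (θ1 * Complex.I) * (Complex.exp (θ2 * Complex.I))⁻¹ := by
    rw [← hexp, ← Complex.exp_add]
    push_cast
    ring_nf
  have hw := Complex.exp_ne_zero (θ1 * Complex.I)
  have hz := Complex.exp_ne_zero (θ2 * Complex.I)
  have hμ' : (μ : ℂ) ≠ 0 := by exact_mod_cast hμ
  have hβ : (β : ℂ) = μ / 2 - α := by
    rw [← hab]
    push_cast
    ring
  simp only [Complex.ofReal_mul, Complex.ofReal_sub, Complex.ofReal_add, Complex.ofReal_pow,
    Complex.ofReal_div, Complex.ofReal_cos, Complex.ofReal_ofNat, Complex.ofReal_one]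
  rw [← Complex.ofReal_sub θ1 θ2, hcos, hcos, hcos, hdiff]
  simp only [KDelta, KPi, hconj, hβ, mul_comm Complex.I]
  generalize Complex.exp (θ1 * Complex.I) = w at *
  generalize Complex.exp (θ2 * Complex.I) = z at *
  simp [Matrix.det_fin_three]
  field_simp
  ring

theorem neg_three_halves_le_cos_add_cos_add_cos_sub (x y : ℝ) :
    -(3 / 2) ≤ Real.cos x + Real.cos y + Real.cos (x - y) := by
  rw [Real.cos_sub]
  nlinarith [sq_nonneg (1 + Real.cos x + Real.cos y), sq_nonneg (Real.sin x + Real.sin y),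
    Real.sin_sq_add_cos_sq x, Real.sin_sq_add_cos_sq y]

/-- Explicit eigenvalues of the monomeric Kagome Floquet Laplacian. -/
theorem kagome_monomeric_eigenvalues
    (μ α β : ℝ) (hμ : 0 < μ) (hα : 0 < α) (hβ : 0 < β) (hab : 2 * (α + β) = μ)
    (θ1 θ2 : ℝ) :
    {lam : ℝ |
        Matrix.det ((lam : ℂ) • (1 : Matrix (Fin 3) (Fin 3) ℂ)
          - KDelta β α β α β α μ θ1 θ2) = 0}
      = {3/2,
         3/4 + (1/4) * Real.sqrt (1 + 8 * (1 +
            ((Real.cos θ1 + Real.cos θ2 + Real.cos (θ1 - θ2)) - 3)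
              * (2 * α / μ - 4 * α ^ 2 / μ ^ 2))),
         3/4 - (1/4) * Real.sqrt (1 + 8 * (1 +
            ((Real.cos θ1 + Real.cos θ2 + Real.cos (θ1 - θ2)) - 3)
              * (2 * α / μ - 4 * α ^ 2 / μ ^ 2)))} := by
  have hD : 0 ≤ 1 + 8 * (1 +
      ((Real.cos θ1 + Real.cos θ2 + Real.cos (θ1 - θ2)) - 3)
        * (2 * α / μ - 4 * α ^ 2 / μ ^ 2)) := by
    have hF := neg_three_halves_le_cos_add_cos_add_cos_sub θ1 θ2
    have hq : 2 * α / μ - 4 * α ^ 2 / μ ^ 2 = 4 * (α / μ) * (β / μ) := by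
      rw [← hab] at hμ ⊢
      field_simp
      ring
    have hq0 : 0 ≤ 2 * α / μ - 4 * α ^ 2 / μ ^ 2 := by
      rw [hq]
      positivity
    have hq1 : 2 * α / μ - 4 * α ^ 2 / μ ^ 2 ≤ 1 / 4 := by
      have h : 2 * α / μ - 4 * α ^ 2 / μ ^ 2 = 1 / 4 - (2 * (α / μ) - 1 / 2) ^ 2 := by ring
      nlinarith [sq_nonneg (2 * (α / μ) - 1 / 2)]
    nlinarith [mul_nonneg hq0 (by linarith : 0 ≤
      Real.cos θ1 + Real.cos θ2 + Real.cos (θ1 - θ2) + 3 / 2)]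
  ext lam
  rw [Set.mem_ofPred_eq, det_smul_one_sub_KDelta_monomeric hμ.ne' hab, Complex.ofReal_eq_zero]
  generalize 1 + 8 * (1 + ((Real.cos θ1 + Real.cos θ2 + Real.cos (θ1 - θ2)) - 3)
    * (2 * α / μ - 4 * α ^ 2 / μ ^ 2)) = D at *
  have hfactor : (lam - 3 / 4) ^ 2 - 1 / 16 * D =
      (lam - (3 / 4 + 1 / 4 * √D)) * (lam - (3 / 4 - 1 / 4 * √D)) := by
    linear_combination 1 / 16 * Real.sq_sqrt hD
  simp only [hfactor, mul_eq_zero, sub_eq_zero, Set.mem_insert_iff, Set.mem_singleton_iff]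
end

section
/- The function F : ℝ² → ℝ defined by F(θ₁,θ₂) = cos(θ₁) + cos(θ₂) + cos(θ₁−θ₂) has range exactly the closed interval [−3/2, 3]; that is, F(θ) ∈ [−3/2, 3] for all θ ∈ ℝ², and every value in [−3/2, 3] is attained. -/
/-- The range of `F(θ₁,θ₂) = cos θ₁ + cos θ₂ + cos (θ₁ − θ₂)` is exactly `[−3/2, 3]`. -/
theorem range_cos_sum_eq_Icc :
    Set.range (fun θ : ℝ × ℝ => Real.cos θ.1 + Real.cos θ.2 + Real.cos (θ.1 - θ.2))
      = Set.Icc (-(3/2) : ℝ) 3 := by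
  ext v
  simp only [Set.mem_range, Set.mem_Icc, Prod.exists]
  constructor
  · rintro ⟨a, b, rfl⟩
    constructor
    · -- `3 + 2 F(a, b)` is the squared modulus of `1 + exp (i a) + exp (i b)`.
      rw [Real.cos_sub]
      nlinarith [sq_nonneg (1 + Real.cos a + Real.cos b), sq_nonneg (Real.sin a + Real.sin b),
        Real.sin_sq_add_cos_sq a, Real.sin_sq_add_cos_sq b]
    · linarith [Real.cos_le_one a, Real.cos_le_one b, Real.cos_le_one (a - b)]
  · rintro ⟨hlo, hhi⟩
    -- On the line `θ₂ = -θ₁` the function is `2 c ^ 2 + 2 c - 1` with `c = cos θ₁`.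
    have hsq : √(3 + 2 * v) ^ 2 = 3 + 2 * v := Real.sq_sqrt (by linarith)
    have hnonneg : 0 ≤ √(3 + 2 * v) := Real.sqrt_nonneg _
    have hle : √(3 + 2 * v) ≤ 3 := Real.sqrt_le_iff.mpr ⟨by norm_num, by linarith⟩
    set t := Real.arccos ((√(3 + 2 * v) - 1) / 2)
    have hcos : Real.cos t = (√(3 + 2 * v) - 1) / 2 :=
      Real.cos_arccos (by linarith) (by linarith)
    refine ⟨t, -t, ?_⟩
    rw [Real.cos_neg, sub_neg_eq_add, ← two_mul t, Real.cos_two_mul, hcos]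
    linear_combination hsq / 2
end

section
/- Let μ > 0 and γ₁,…,γ₉ > 0 satisfy the Super-Kagome constant-vertex-weight conditions μ = γ₂+γ₃+γ₇ = γ₅+γ₆+γ₇ = γ₁+γ₂+γ₈ = γ₄+γ₅+γ₈ = γ₁+γ₃+γ₉ = γ₄+γ₆+γ₉. Then the following are equivalent: (i) there exist exactly two distinct real numbers E such that det(E·Id − Δ^θ_γ) = 0 for every θ ∈ ℝ² (exactly two flat bands); (ii) there exist α, β > 0 with 2α + β = μ such that γ₁ = γ₂ = γ₃ = γ₄ = γ₅ = γ₆ = α and γ₇ = γ₈ = γ₉ = β. -/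
open Matrix

/-- The Super-Kagome Floquet adjacency matrix `Π^θ_γ`. -/
noncomputable def SKPi (g1 g2 g3 g4 g5 g6 g7 g8 g9 θ1 θ2 : ℝ) : Matrix (Fin 6) (Fin 6) ℂ :=
  let w : ℂ := Complex.exp (Complex.I * θ1)
  let z : ℂ := Complex.exp (Complex.I * θ2)
  !![0, (g4 : ℂ), (g6 : ℂ), 0, z * g9, 0;
     (g4 : ℂ), 0, (g5 : ℂ), 0, 0, w * g8;
     (g6 : ℂ), (g5 : ℂ), 0, (g7 : ℂ), 0, 0;
     0, 0, (g7 : ℂ), 0, (g3 : ℂ), (g2 : ℂ);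
     (starRingEnd ℂ) z * g9, 0, 0, (g3 : ℂ), 0, (g1 : ℂ);
     0, (starRingEnd ℂ) w * g8, 0, (g2 : ℂ), (g1 : ℂ), 0]

/-- The Super-Kagome Floquet Laplacian `Δ^θ_γ = Id − (1/μ) Π^θ_γ`. -/
noncomputable def SKDelta (g1 g2 g3 g4 g5 g6 g7 g8 g9 μ θ1 θ2 : ℝ) : Matrix (Fin 6) (Fin 6) ℂ :=
  1 - (μ : ℂ)⁻¹ • SKPi g1 g2 g3 g4 g5 g6 g7 g8 g9 θ1 θ2

/-- The determinant of the bordered `6 × 6` matrix with constant diagonal `x`, two copies of the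
weighted triangle `(a, b, c)` and connecting edges `p, q, r`, as a Laurent polynomial in the
phases `z, w`. -/
lemma det_doubled_triangle (x a b c p q r z z' w w' : ℂ) (hz : z * z' = 1) (hw : w * w' = 1) :
    Matrix.det !![x, a, c, 0, z * p, 0;
      a, x, b, 0, 0, w * q;
      c, b, x, r, 0, 0;
      0, 0, r, x, c, b;
      z' * p, 0, 0, c, x, a;
      0, w' * q, 0, b, a, x] =
    (x ^ 3 + 2 * a * b * c - x * (a ^ 2 + b ^ 2 + c ^ 2)) ^ 2
      - p ^ 2 * (x ^ 2 - b ^ 2) ^ 2 - q ^ 2 * (x ^ 2 - c ^ 2) ^ 2 - r ^ 2 * (x ^ 2 - a ^ 2) ^ 2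
      + (p ^ 2 * q ^ 2 + p ^ 2 * r ^ 2 + q ^ 2 * r ^ 2) * x ^ 2 - p ^ 2 * q ^ 2 * r ^ 2
      - p * r * ((c * x - a * b) ^ 2 - c ^ 2 * q ^ 2) * (z + z')
      - q * r * ((b * x - a * c) ^ 2 - b ^ 2 * p ^ 2) * (w + w')
      - p * q * ((a * x - b * c) ^ 2 - a ^ 2 * r ^ 2) * (z * w' + z' * w) := by
  have key : Matrix.det !![x, a, c, 0, z * p, 0;
      a, x, b, 0, 0, w * q;
      c, b, x, r, 0, 0;
      0, 0, r, x, c, b;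
      z' * p, 0, 0, c, x, a;
      0, w' * q, 0, b, a, x] =
    (x ^ 3 + 2 * a * b * c - x * (a ^ 2 + b ^ 2 + c ^ 2)) ^ 2
      - (z * z') * p ^ 2 * (x ^ 2 - b ^ 2) ^ 2 - (w * w') * q ^ 2 * (x ^ 2 - c ^ 2) ^ 2
      - r ^ 2 * (x ^ 2 - a ^ 2) ^ 2
      + ((z * z') * (w * w') * p ^ 2 * q ^ 2 + (z * z') * p ^ 2 * r ^ 2
        + (w * w') * q ^ 2 * r ^ 2) * x ^ 2 - (z * z') * (w * w') * p ^ 2 * q ^ 2 * r ^ 2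
      - p * r * ((c * x - a * b) ^ 2 - (w * w') * c ^ 2 * q ^ 2) * (z + z')
      - q * r * ((b * x - a * c) ^ 2 - (z * z') * b ^ 2 * p ^ 2) * (w + w')
      - p * q * ((a * x - b * c) ^ 2 - a ^ 2 * r ^ 2) * (z * w' + z' * w) := by
    simp [Matrix.det_succ_row_zero, Fin.sum_univ_succ, Fin.succAbove]
    ring
  rw [key, hz, hw]
  ring

/-- The shifted Floquet Laplacian is a multiple of the doubled-triangle matrix. -/
lemma smul_one_sub_SKDelta (E μ a b c p q r θ1 θ2 : ℝ) (hμ : μ ≠ 0) :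
    (E : ℂ) • (1 : Matrix (Fin 6) (Fin 6) ℂ) - SKDelta a b c a b c r q p μ θ1 θ2 =
    (μ : ℂ)⁻¹ • !![((μ * (E - 1) : ℝ) : ℂ), (a : ℂ), (c : ℂ), 0, Complex.exp (Complex.I * θ2) * p, 0;
      (a : ℂ), ((μ * (E - 1) : ℝ) : ℂ), (b : ℂ), 0, 0, Complex.exp (Complex.I * θ1) * q;
      (c : ℂ), (b : ℂ), ((μ * (E - 1) : ℝ) : ℂ), (r : ℂ), 0, 0;
      0, 0, (r : ℂ), ((μ * (E - 1) : ℝ) : ℂ), (c : ℂ), (b : ℂ);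
      (starRingEnd ℂ) (Complex.exp (Complex.I * θ2)) * p, 0, 0, (c : ℂ),
        ((μ * (E - 1) : ℝ) : ℂ), (a : ℂ);
      0, (starRingEnd ℂ) (Complex.exp (Complex.I * θ1)) * q, 0, (b : ℂ), (a : ℂ),
        ((μ * (E - 1) : ℝ) : ℂ)] := by
  have hμ' : (μ : ℂ) ≠ 0 := by exact_mod_cast hμ
  ext i j
  fin_cases i <;> fin_cases j <;> simp [SKDelta, SKPi, hμ']

lemma exp_I_mul_conj (θ : ℝ) :
    Complex.exp (Complex.I * θ) * (starRingEnd ℂ) (Complex.exp (Complex.I * θ)) = 1 := by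
  rw [← Complex.exp_conj, ← Complex.exp_add]
  simp

/-- The determinant of the shifted Floquet Laplacian vanishes at given phases iff its numerator,
a trigonometric polynomial, does. -/
lemma det_SKDelta_eq_zero_iff (E μ a b c p q r θ1 θ2 : ℝ) (hμ : μ ≠ 0) :
    Matrix.det ((E : ℂ) • (1 : Matrix (Fin 6) (Fin 6) ℂ)
      - SKDelta a b c a b c r q p μ θ1 θ2) = 0 ↔
    ∀ x z z' w w' : ℂ, x = ((μ * (E - 1) : ℝ) : ℂ) →
      z = Complex.exp (Complex.I * θ2) → z' = (starRingEnd ℂ) (Complex.exp (Complex.I * θ2)) →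
      w = Complex.exp (Complex.I * θ1) → w' = (starRingEnd ℂ) (Complex.exp (Complex.I * θ1)) →
    (x ^ 3 + 2 * a * b * c - x * (a ^ 2 + b ^ 2 + c ^ 2)) ^ 2
      - p ^ 2 * (x ^ 2 - b ^ 2) ^ 2 - q ^ 2 * (x ^ 2 - c ^ 2) ^ 2 - r ^ 2 * (x ^ 2 - a ^ 2) ^ 2
      + (p ^ 2 * q ^ 2 + p ^ 2 * r ^ 2 + q ^ 2 * r ^ 2) * x ^ 2 - p ^ 2 * q ^ 2 * r ^ 2
      - p * r * ((c * x - a * b) ^ 2 - c ^ 2 * q ^ 2) * (z + z')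
      - q * r * ((b * x - a * c) ^ 2 - b ^ 2 * p ^ 2) * (w + w')
      - p * q * ((a * x - b * c) ^ 2 - a ^ 2 * r ^ 2) * (z * w' + z' * w) = 0 := by
  have hμ' : (μ : ℂ)⁻¹ ^ 6 ≠ 0 := pow_ne_zero _ (inv_ne_zero (by exact_mod_cast hμ))
  rw [smul_one_sub_SKDelta E μ a b c p q r θ1 θ2 hμ, Matrix.det_smul, Fintype.card_fin,
    mul_eq_zero, or_iff_right hμ',
    det_doubled_triangle _ _ _ _ _ _ _ _ _ _ _ (exp_I_mul_conj θ2) (exp_I_mul_conj θ1)]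
  constructor
  · rintro h _ _ _ _ _ rfl rfl rfl rfl rfl
    exact h
  · exact fun h => h _ _ _ _ _ rfl rfl rfl rfl rfl

/-- A flat band annihilates the three nonconstant Fourier coefficients of the determinant. -/
lemma flat_band_quadratics {E μ a b c p q r : ℝ} (hμ : μ ≠ 0) (hp : p ≠ 0) (hq : q ≠ 0)
    (hr : r ≠ 0)
    (h : ∀ θ1 θ2 : ℝ, Matrix.det ((E : ℂ) • (1 : Matrix (Fin 6) (Fin 6) ℂ)
      - SKDelta a b c a b c r q p μ θ1 θ2) = 0) :
    (c * (μ * (E - 1)) - a * b) ^ 2 = c ^ 2 * q ^ 2 ∧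
    (b * (μ * (E - 1)) - a * c) ^ 2 = b ^ 2 * p ^ 2 ∧
    (a * (μ * (E - 1)) - b * c) ^ 2 = a ^ 2 * r ^ 2 := by
  have e0 : Complex.exp (Complex.I * (0 : ℝ)) = 1 := by simp
  have eπ : Complex.exp (Complex.I * (Real.pi : ℝ)) = -1 := by
    rw [mul_comm, Complex.exp_pi_mul_I]
  have f (θ1 θ2 : ℝ) := (det_SKDelta_eq_zero_iff E μ a b c p q r θ1 θ2 hμ).1 (h θ1 θ2)
  have f1 := f 0 0 _ 1 1 1 1 rfl e0.symm (by simp) e0.symm (by simp)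
  have f2 := f 0 Real.pi _ (-1) (-1) 1 1 rfl eπ.symm (by simp [eπ]) e0.symm (by simp)
  have f3 := f Real.pi 0 _ 1 1 (-1) (-1) rfl e0.symm (by simp) eπ.symm (by simp [eπ])
  have f4 := f Real.pi Real.pi _ (-1) (-1) (-1) (-1) rfl eπ.symm (by simp [eπ]) eπ.symm
    (by simp [eπ])
  norm_cast at f1 f2 f3 f4
  push_cast at f1 f2 f3 f4
  refine ⟨?_, ?_, ?_⟩
  · refine mul_left_cancel₀ (mul_ne_zero hp hr) ?_
    linear_combination (-1 / 8) * (f1 - f2 + f3 - f4)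
  · refine mul_left_cancel₀ (mul_ne_zero hq hr) ?_
    linear_combination (-1 / 8) * (f1 + f2 - f3 - f4)
  · refine mul_left_cancel₀ (mul_ne_zero hp hq) ?_
    linear_combination (-1 / 8) * (f1 - f2 - f3 + f4)

/-- With monomeric weights the flat bands are exactly `1 + (α ± β) / μ`. -/
lemma monomeric_flat_band_iff {E μ α β : ℝ} (hμ : μ ≠ 0) (hα : α ≠ 0) (hβ : β ≠ 0) :
    (∀ θ1 θ2 : ℝ, Matrix.det ((E : ℂ) • (1 : Matrix (Fin 6) (Fin 6) ℂ)
      - SKDelta α α α α α α β β β μ θ1 θ2) = 0) ↔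
    E = 1 + (α + β) / μ ∨ E = 1 + (α - β) / μ := by
  have hE (t : ℝ) : E = 1 + t / μ ↔ μ * (E - 1) = t := by
    rw [← sub_eq_iff_eq_add', eq_div_iff hμ, mul_comm]
  rw [hE, hE]
  constructor
  · intro h
    have h1 := (flat_band_quadratics hμ hβ hβ hβ h).1
    have h2 : (μ * (E - 1) - α) ^ 2 = β ^ 2 := by
      refine mul_left_cancel₀ (pow_ne_zero 2 hα) ?_
      linear_combination h1
    rcases sq_eq_sq_iff_eq_or_eq_neg.1 h2 with h3 | h3
    · left; linarith
    · right; linarith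
  · intro h θ1 θ2
    rw [det_SKDelta_eq_zero_iff _ _ _ _ _ _ _ _ _ _ hμ]
    rintro x z z' w w' hx - - - -
    rcases h with h | h <;> rw [h] at hx <;> subst hx <;> push_cast <;> ring

/-- If all three quadratics share two distinct roots, the sums of their roots agree. -/
lemma mul_eq_mul_of_two_roots {x y a b c s t : ℝ} (hxy : x ≠ y)
    (hb : b ≠ 0) (hc : c ≠ 0)
    (hx1 : (c * x - a * b) ^ 2 = c ^ 2 * s) (hy1 : (c * y - a * b) ^ 2 = c ^ 2 * s)
    (hx2 : (b * x - a * c) ^ 2 = b ^ 2 * t) (hy2 : (b * y - a * c) ^ 2 = b ^ 2 * t) :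
    a * (b * b) = a * (c * c) := by
  have h1 : c * (x + y) = 2 * (a * b) := by
    refine mul_left_cancel₀ (mul_ne_zero hc (sub_ne_zero.2 hxy)) ?_
    linear_combination hx1 - hy1
  have h2 : b * (x + y) = 2 * (a * c) := by
    refine mul_left_cancel₀ (mul_ne_zero hb (sub_ne_zero.2 hxy)) ?_
    linear_combination hx2 - hy2
  linear_combination (c / 2) * h2 - (b / 2) * h1

/-- The constant-vertex-weight Super-Kagome Laplacian has exactly two flat bands iff the
weights are monomeric. -/
theorem super_kagome_two_flat_bands_iff_monomeric
    (μ g1 g2 g3 g4 g5 g6 g7 g8 g9 : ℝ) (hμ : 0 < μ)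
    (h1 : 0 < g1) (h2 : 0 < g2) (h3 : 0 < g3) (h4 : 0 < g4) (h5 : 0 < g5) (h6 : 0 < g6)
    (h7 : 0 < g7) (h8 : 0 < g8) (h9 : 0 < g9)
    (e1 : μ = g2 + g3 + g7) (e2 : μ = g5 + g6 + g7)
    (e3 : μ = g1 + g2 + g8) (e4 : μ = g4 + g5 + g8)
    (e5 : μ = g1 + g3 + g9) (e6 : μ = g4 + g6 + g9) :
    ({E : ℝ | ∀ θ1 θ2 : ℝ,
        Matrix.det ((E : ℂ) • (1 : Matrix (Fin 6) (Fin 6) ℂ)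
          - SKDelta g1 g2 g3 g4 g5 g6 g7 g8 g9 μ θ1 θ2) = 0}.encard = 2)
    ↔ (∃ α β : ℝ, 0 < α ∧ 0 < β ∧ 2 * α + β = μ ∧
        g1 = α ∧ g2 = α ∧ g3 = α ∧ g4 = α ∧ g5 = α ∧ g6 = α ∧
        g7 = β ∧ g8 = β ∧ g9 = β) := by
  obtain rfl : g4 = g1 := by linarith
  obtain rfl : g5 = g2 := by linarith
  obtain rfl : g6 = g3 := by linarith
  constructor
  · intro h
    obtain ⟨E, F, hEF, hS⟩ := Set.encard_eq_two.1 h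
    have hE := hS.ge (Set.mem_insert E {F})
    have hF := hS.ge (Set.mem_insert_of_mem E (Set.mem_singleton F))
    obtain ⟨E1, E2, E3⟩ := flat_band_quadratics hμ.ne' h9.ne' h8.ne' h7.ne' hE
    obtain ⟨F1, F2, F3⟩ := flat_band_quadratics hμ.ne' h9.ne' h8.ne' h7.ne' hF
    have hxy : μ * (E - 1) ≠ μ * (F - 1) := fun h =>
      hEF (sub_left_injective (mul_left_cancel₀ hμ.ne' h))
    have hbc := mul_left_cancel₀ h4.ne'
      (mul_eq_mul_of_two_roots hxy h5.ne' h6.ne' E1 F1 E2 F2)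
    have hab := mul_left_cancel₀ h6.ne' (mul_eq_mul_of_two_roots (a := g6)
      (s := g9 ^ 2) (t := g7 ^ 2) hxy h4.ne' h5.ne'
      (by linear_combination E2) (by linear_combination F2)
      (by linear_combination E3) (by linear_combination F3))
    rw [mul_self_inj_of_nonneg (by positivity) (by positivity)] at hbc hab
    subst hbc hab
    exact ⟨_, g7, h4, h7, by linarith, rfl, rfl, rfl, rfl, rfl, rfl, rfl, by linarith,
      by linarith⟩
  · rintro ⟨α, β, hα, hβ, -, rfl, rfl, rfl, -, -, -, rfl, rfl, rfl⟩
    refine Set.encard_eq_two.2 ⟨1 + (g6 + g9) / μ, 1 + (g6 - g9) / μ, ?_, ?_⟩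
    · intro h
      field_simp at h
      linarith
    · ext E
      exact monomeric_flat_band_iff hμ.ne' h6.ne' h9.ne'
end

section
/- Let γ₁, γ₂, γ₃, γ₇, γ₈, γ₉ > 0, set γ₄ = γ₁, γ₅ = γ₂, γ₆ = γ₃, and let λ ∈ ℝ. Then det(λ·Id − Π^θ_γ) = 0 for every θ ∈ ℝ² if and only if the following four conditions hold: λ²γ₂² + 2λγ₁γ₂γ₃ + γ₁²γ₃² − γ₂²γ₉² = 0; λ²γ₃² + 2λγ₁γ₂γ₃ + γ₁²γ₂² − γ₃²γ₈² = 0; λ²γ₁² + 2λγ₁γ₂γ₃ + γ₂²γ₃² − γ₁²γ₇² = 0; and λ⁶ − λ⁴(2γ₁² + 2γ₂² + 2γ₃² + γ₇² + γ₈² + γ₉²) − 4λ³γ₁γ₂γ₃ + λ²(γ₁⁴ + γ₂⁴ + γ₃⁴ + 2γ₁²γ₂² + 2γ₂²γ₃² + 2γ₃²γ₁² + 2γ₁²γ₇² + 2γ₂²γ₉² + 2γ₃²γ₈² + γ₇²γ₈² + γ₈²γ₉² + γ₉²γ₇²) + 4λγ₁γ₂γ₃(γ₁² + γ₂² + γ₃²)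 − γ₁⁴γ₇² − γ₂⁴γ₉² − γ₃⁴γ₈² − γ₇²γ₈²γ₉² + 4γ₁²γ₂²γ₃² = 0. -/
open Matrix

/-- The characteristic determinant of the Super-Kagome matrix as a Laurent polynomial in the
phases `w` and `z`. -/
theorem det_superKagome (a b c p q r l w z : ℂ) (hw : w ≠ 0) (hz : z ≠ 0) :
    Matrix.det !![l, -a, -c, 0, -(z * r), 0;
      -a, l, -b, 0, 0, -(w * q);
      -c, -b, l, -p, 0, 0;
      0, 0, -p, l, -c, -b;
      -(z⁻¹ * r), 0, 0, -c, l, -a;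
      0, -(w⁻¹ * q), 0, -b, -a, l] =
    (l ^ 6
      - l ^ 4 * (2 * a ^ 2 + 2 * b ^ 2 + 2 * c ^ 2 + p ^ 2 + q ^ 2 + r ^ 2)
      - 4 * l ^ 3 * a * b * c
      + l ^ 2 * (a ^ 4 + b ^ 4 + c ^ 4
          + 2 * a ^ 2 * b ^ 2 + 2 * b ^ 2 * c ^ 2 + 2 * c ^ 2 * a ^ 2
          + 2 * a ^ 2 * p ^ 2 + 2 * b ^ 2 * r ^ 2 + 2 * c ^ 2 * q ^ 2
          + p ^ 2 * q ^ 2 + q ^ 2 * r ^ 2 + r ^ 2 * p ^ 2)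
      + 4 * l * a * b * c * (a ^ 2 + b ^ 2 + c ^ 2)
      - a ^ 4 * p ^ 2 - b ^ 4 * r ^ 2 - c ^ 4 * q ^ 2
      - p ^ 2 * q ^ 2 * r ^ 2 + 4 * a ^ 2 * b ^ 2 * c ^ 2)
    - p * q * (w + w⁻¹)
      * (l ^ 2 * b ^ 2 + 2 * l * a * b * c + a ^ 2 * c ^ 2 - b ^ 2 * r ^ 2)
    - p * r * (z + z⁻¹)
      * (l ^ 2 * c ^ 2 + 2 * l * a * b * c + a ^ 2 * b ^ 2 - c ^ 2 * q ^ 2)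
    - q * r * (w * z⁻¹ + w⁻¹ * z)
      * (l ^ 2 * a ^ 2 + 2 * l * a * b * c + b ^ 2 * c ^ 2 - a ^ 2 * p ^ 2) := by
  simp [Matrix.det_succ_row_zero, Fin.sum_univ_succ, Fin.succAbove]
  field_simp
  ring

/-- The characteristic determinant of `SKPi` under the reduction `γ₄ = γ₁`, `γ₅ = γ₂`,
`γ₆ = γ₃`, as a real trigonometric polynomial. -/
theorem det_sub_SKPi (a b c p q r l s t : ℝ) :
    Matrix.det ((l : ℂ) • (1 : Matrix (Fin 6) (Fin 6) ℂ) - SKPi a b c a b c p q r s t) =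
    (((l ^ 6
      - l ^ 4 * (2 * a ^ 2 + 2 * b ^ 2 + 2 * c ^ 2 + p ^ 2 + q ^ 2 + r ^ 2)
      - 4 * l ^ 3 * a * b * c
      + l ^ 2 * (a ^ 4 + b ^ 4 + c ^ 4
          + 2 * a ^ 2 * b ^ 2 + 2 * b ^ 2 * c ^ 2 + 2 * c ^ 2 * a ^ 2
          + 2 * a ^ 2 * p ^ 2 + 2 * b ^ 2 * r ^ 2 + 2 * c ^ 2 * q ^ 2
          + p ^ 2 * q ^ 2 + q ^ 2 * r ^ 2 + r ^ 2 * p ^ 2)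
      + 4 * l * a * b * c * (a ^ 2 + b ^ 2 + c ^ 2)
      - a ^ 4 * p ^ 2 - b ^ 4 * r ^ 2 - c ^ 4 * q ^ 2
      - p ^ 2 * q ^ 2 * r ^ 2 + 4 * a ^ 2 * b ^ 2 * c ^ 2)
    - p * q * (2 * Real.cos s)
      * (l ^ 2 * b ^ 2 + 2 * l * a * b * c + a ^ 2 * c ^ 2 - b ^ 2 * r ^ 2)
    - p * r * (2 * Real.cos t)
      * (l ^ 2 * c ^ 2 + 2 * l * a * b * c + a ^ 2 * b ^ 2 - c ^ 2 * q ^ 2)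
    - q * r * (2 * Real.cos (s - t))
      * (l ^ 2 * a ^ 2 + 2 * l * a * b * c + b ^ 2 * c ^ 2 - a ^ 2 * p ^ 2) : ℝ) : ℂ) := by
  have conj_exp (x : ℝ) : (starRingEnd ℂ) (Complex.exp (Complex.I * x)) =
      (Complex.exp (Complex.I * x))⁻¹ := by
    rw [← Complex.exp_conj, ← Complex.exp_neg]; simp
  have two_cos (x : ℂ) : Complex.exp (Complex.I * x) + (Complex.exp (Complex.I * x))⁻¹ =
      2 * Complex.cos x := by
    rw [Complex.two_cos, ← Complex.exp_neg]; ring_nf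
  have two_cos_sub : Complex.exp (Complex.I * s) * (Complex.exp (Complex.I * t))⁻¹ +
      (Complex.exp (Complex.I * s))⁻¹ * Complex.exp (Complex.I * t) =
      2 * Complex.cos (s - t) := by
    rw [← two_cos, mul_sub, Complex.exp_sub, div_eq_mul_inv, mul_inv, inv_inv]
  have hM : (l : ℂ) • (1 : Matrix (Fin 6) (Fin 6) ℂ) - SKPi a b c a b c p q r s t =
      !![(l : ℂ), -a, -c, 0, -(Complex.exp (Complex.I * t) * r), 0;
        -a, l, -b, 0, 0, -(Complex.exp (Complex.I * s) * q);
        -c, -b, l, -p, 0, 0;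
        0, 0, -p, l, -c, -b;
        -((Complex.exp (Complex.I * t))⁻¹ * r), 0, 0, -c, l, -a;
        0, -((Complex.exp (Complex.I * s))⁻¹ * q), 0, -b, -a, l] := by
    ext i j
    fin_cases i <;> fin_cases j <;> simp [SKPi, conj_exp]
  rw [hM, det_superKagome _ _ _ _ _ _ _ _ _ (Complex.exp_ne_zero _) (Complex.exp_ne_zero _),
    two_cos, two_cos, two_cos_sub]
  push_cast
  ring

/-- Conditions for `λ` to be a `θ`-independent eigenvalue of the Super-Kagome Floquet
adjacency matrix (after the reduction `γ₄ = γ₁`, `γ₅ = γ₂`, `γ₆ = γ₃`). -/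
theorem super_kagome_theta_independent_eigenvalue_iff
    (g1 g2 g3 g7 g8 g9 : ℝ)
    (h1 : 0 < g1) (h2 : 0 < g2) (h3 : 0 < g3)
    (h7 : 0 < g7) (h8 : 0 < g8) (h9 : 0 < g9)
    (lam : ℝ) :
    (∀ θ1 θ2 : ℝ,
      Matrix.det ((lam : ℂ) • (1 : Matrix (Fin 6) (Fin 6) ℂ)
        - SKPi g1 g2 g3 g1 g2 g3 g7 g8 g9 θ1 θ2) = 0)
    ↔ (lam ^ 2 * g2 ^ 2 + 2 * lam * g1 * g2 * g3 + g1 ^ 2 * g3 ^ 2 - g2 ^ 2 * g9 ^ 2 = 0 ∧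
       lam ^ 2 * g3 ^ 2 + 2 * lam * g1 * g2 * g3 + g1 ^ 2 * g2 ^ 2 - g3 ^ 2 * g8 ^ 2 = 0 ∧
       lam ^ 2 * g1 ^ 2 + 2 * lam * g1 * g2 * g3 + g2 ^ 2 * g3 ^ 2 - g1 ^ 2 * g7 ^ 2 = 0 ∧
       lam ^ 6
         - lam ^ 4 * (2 * g1 ^ 2 + 2 * g2 ^ 2 + 2 * g3 ^ 2 + g7 ^ 2 + g8 ^ 2 + g9 ^ 2)
         - 4 * lam ^ 3 * g1 * g2 * g3
         + lam ^ 2 * (g1 ^ 4 + g2 ^ 4 + g3 ^ 4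
             + 2 * g1 ^ 2 * g2 ^ 2 + 2 * g2 ^ 2 * g3 ^ 2 + 2 * g3 ^ 2 * g1 ^ 2
             + 2 * g1 ^ 2 * g7 ^ 2 + 2 * g2 ^ 2 * g9 ^ 2 + 2 * g3 ^ 2 * g8 ^ 2
             + g7 ^ 2 * g8 ^ 2 + g8 ^ 2 * g9 ^ 2 + g9 ^ 2 * g7 ^ 2)
         + 4 * lam * g1 * g2 * g3 * (g1 ^ 2 + g2 ^ 2 + g3 ^ 2)
         - g1 ^ 4 * g7 ^ 2 - g2 ^ 4 * g9 ^ 2 - g3 ^ 4 * g8 ^ 2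
         - g7 ^ 2 * g8 ^ 2 * g9 ^ 2 + 4 * g1 ^ 2 * g2 ^ 2 * g3 ^ 2 = 0) := by
  simp only [det_sub_SKPi, Complex.ofReal_eq_zero]
  constructor
  · intro h
    have e1 := h 0 0
    have e2 := h 0 Real.pi
    have e3 := h Real.pi 0
    have e4 := h Real.pi Real.pi
    simp only [sub_zero, zero_sub, sub_self, Real.cos_neg, Real.cos_zero, Real.cos_pi]
      at e1 e2 e3 e4
    refine ⟨?_, ?_, ?_, ?_⟩
    · refine (mul_eq_zero.mp ?_).resolve_left (mul_pos h7 h8).ne'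
      linear_combination (-e1 - e2 + e3 + e4) / 8
    · refine (mul_eq_zero.mp ?_).resolve_left (mul_pos h7 h9).ne'
      linear_combination (-e1 + e2 - e3 + e4) / 8
    · refine (mul_eq_zero.mp ?_).resolve_left (mul_pos h8 h9).ne'
      linear_combination (-e1 + e2 + e3 - e4) / 8
    · linear_combination (e1 + e2 + e3 + e4) / 4
  · rintro ⟨c1, c2, c3, c4⟩ s t
    rw [c1, c2, c3, c4]
    ring
end

section
/- Let μ > 0 and γ₁, γ₂, γ₃, γ₇, γ₈, γ₉ > 0 satisfy γ₁ + γ₃ + γ₉ = γ₁ + γ₂ + γ₈ = γ₂ + γ₃ + γ₇ = μ. Then the equalities −γ₁γ₃/γ₂ − γ₉ = −γ₁γ₂/γ₃ + γ₈ = −γ₂γ₃/γ₁ + γ₇ hold if and only if there exists α' ∈ (μ/2, μ) such that, setting β' = μ − 3α' + √(17α'² − 8α'μ), one has γ₂ = α', γ₁ = γ₃ = (μ − β')/2, γ₇ = γ₈ = (μ + β')/2 − α', and γ₉ = β'. -/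
/-- Case(−,+,+): complete description of the one-flat-band solution family. -/
theorem super_kagome_case_mpp
    (μ g1 g2 g3 g7 g8 g9 : ℝ) (hμ : 0 < μ)
    (h1 : 0 < g1) (h2 : 0 < g2) (h3 : 0 < g3)
    (h7 : 0 < g7) (h8 : 0 < g8) (h9 : 0 < g9)
    (e1 : g1 + g3 + g9 = μ) (e2 : g1 + g2 + g8 = μ) (e3 : g2 + g3 + g7 = μ) :
    (-(g1 * g3) / g2 - g9 = -(g1 * g2) / g3 + g8 ∧
     -(g1 * g2) / g3 + g8 = -(g2 * g3) / g1 + g7)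
    ↔ (∃ α' : ℝ, α' ∈ Set.Ioo (μ / 2) μ ∧
        g2 = α' ∧
        g1 = (μ - (μ - 3 * α' + Real.sqrt (17 * α' ^ 2 - 8 * α' * μ))) / 2 ∧
        g3 = (μ - (μ - 3 * α' + Real.sqrt (17 * α' ^ 2 - 8 * α' * μ))) / 2 ∧
        g7 = (μ + (μ - 3 * α' + Real.sqrt (17 * α' ^ 2 - 8 * α' * μ))) / 2 - α' ∧
        g8 = (μ + (μ - 3 * α' + Real.sqrt (17 * α' ^ 2 - 8 * α' * μ))) / 2 - α' ∧
        g9 = μ - 3 * α' + Real.sqrt (17 * α' ^ 2 - 8 * α' * μ)) := by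
  constructor
  · rintro ⟨hA, hB⟩
    obtain rfl : g9 = μ - g1 - g3 := by linarith
    obtain rfl : g8 = μ - g1 - g2 := by linarith
    obtain rfl : g7 = μ - g2 - g3 := by linarith
    have h13 : g1 = g3 := by
      field_simp at hB
      have hprod : (g3 - g1) * (g2 * (g1 + g3) + g1 * g3) = 0 := by linarith
      have hpos : g2 * (g1 + g3) + g1 * g3 ≠ 0 := by positivity
      linarith [(mul_eq_zero.mp hprod).resolve_right hpos]
    subst h13
    have hquad : g1 ^ 2 - 3 * g1 * g2 - 2 * g2 ^ 2 + 2 * μ * g2 = 0 := by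
      field_simp at hA
      linarith
    have hlt : g1 < g2 := by
      have : 0 < g1 * (g2 - g1) := by
        have := mul_pos h2 h8
        linarith
      linarith [(mul_pos_iff_of_pos_left h1).mp this]
    have hμ2 : μ / 2 < g2 := by
      have h : 0 < g2 * (2 * g2 - μ) := by
        have : 0 < (g2 - g1) * (2 * g2 - g1) := mul_pos (by linarith) (by linarith)
        linarith
      linarith [(mul_pos_iff_of_pos_left h2).mp h]
    have hs : Real.sqrt (17 * g2 ^ 2 - 8 * g2 * μ) = 3 * g2 - 2 * g1 := by
      rw [show 17 * g2 ^ 2 - 8 * g2 * μ = (3 * g2 - 2 * g1) ^ 2 by linarith]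
      exact Real.sqrt_sq (by linarith)
    refine ⟨g2, ⟨hμ2, by linarith⟩, rfl, ?_⟩
    rw [hs]
    refine ⟨?_, ?_, ?_, ?_, ?_⟩ <;> ring
  · rintro ⟨α', ⟨hα, -⟩, rfl, hg1, hg3, -, -, -⟩
    have hnn : 0 ≤ 17 * g2 ^ 2 - 8 * g2 * μ := by nlinarith
    have hs := Real.sq_sqrt hnn
    rw [show Real.sqrt (17 * g2 ^ 2 - 8 * g2 * μ) = 3 * g2 - 2 * g1 by linarith] at hs
    obtain rfl : g3 = g1 := hg3.trans hg1.symm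
    obtain rfl : g9 = μ - g3 - g3 := by linarith
    obtain rfl : g8 = μ - g3 - g2 := by linarith
    obtain rfl : g7 = μ - g2 - g3 := by linarith
    constructor
    · field_simp
      linarith
    · ring
end

section
/- Let μ > 0 and γ₁, γ₂, γ₃, γ₇, γ₈, γ₉ > 0 satisfy γ₁ + γ₃ + γ₉ = γ₁ + γ₂ + γ₈ = γ₂ + γ₃ + γ₇ = μ and additionally γ₁ = γ₃. Then the equalities −γ₁γ₃/γ₂ + γ₉ = −γ₁γ₂/γ₃ − γ₈ = −γ₂γ₃/γ₁ − γ₇ hold if and only if there exists α' ∈ (0, μ/2) such that, setting β' = μ + 3α' − √(9α'² + 8α'μ), one has γ₂ = α', γ₁ = γ₃ = (μ − β')/2, γ₇ = γ₈ = (μ + β')/2 − α', and γ₉ = β'. -/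
/-- Case(+,−,−), branch `γ₁ = γ₃`: complete description of the one-flat-band solution
family. -/
theorem super_kagome_case_pmm_a
    (μ g1 g2 g3 g7 g8 g9 : ℝ) (hμ : 0 < μ)
    (h1 : 0 < g1) (h2 : 0 < g2) (h3 : 0 < g3)
    (h7 : 0 < g7) (h8 : 0 < g8) (h9 : 0 < g9)
    (e1 : g1 + g3 + g9 = μ) (e2 : g1 + g2 + g8 = μ) (e3 : g2 + g3 + g7 = μ)
    (h13 : g1 = g3) :
    (-(g1 * g3) / g2 + g9 = -(g1 * g2) / g3 - g8 ∧
     -(g1 * g2) / g3 - g8 = -(g2 * g3) / g1 - g7)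
    ↔ (∃ α' : ℝ, α' ∈ Set.Ioo (0 : ℝ) (μ / 2) ∧
        g2 = α' ∧
        g1 = (μ - (μ + 3 * α' - Real.sqrt (9 * α' ^ 2 + 8 * α' * μ))) / 2 ∧
        g3 = (μ - (μ + 3 * α' - Real.sqrt (9 * α' ^ 2 + 8 * α' * μ))) / 2 ∧
        g7 = (μ + (μ + 3 * α' - Real.sqrt (9 * α' ^ 2 + 8 * α' * μ))) / 2 - α' ∧
        g8 = (μ + (μ + 3 * α' - Real.sqrt (9 * α' ^ 2 + 8 * α' * μ))) / 2 - α' ∧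
        g9 = μ + 3 * α' - Real.sqrt (9 * α' ^ 2 + 8 * α' * μ)) := by
  subst h13
  obtain rfl : g9 = μ - 2 * g1 := by linarith
  obtain rfl : g8 = μ - g1 - g2 := by linarith
  obtain rfl : g7 = μ - g1 - g2 := by linarith
  have hc : g1 * g2 / g1 = g2 := mul_div_cancel_left₀ g2 h1.ne'
  have hc' : g2 * g1 / g1 = g2 := mul_div_cancel_right₀ g2 h1.ne'
  have key : (-(g1 * g1) / g2 + (μ - 2 * g1) = -(g1 * g2) / g1 - (μ - g1 - g2) ∧
      -(g1 * g2) / g1 - (μ - g1 - g2) = -(g2 * g1) / g1 - (μ - g1 - g2)) ↔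
      g1 ^ 2 + 3 * g1 * g2 = 2 * μ * g2 := by
    rw [neg_div _ (g1 * g2), neg_div _ (g2 * g1), hc, hc']
    refine ⟨fun ⟨h, _⟩ => ?_, fun h => ⟨?_, rfl⟩⟩
    · field_simp at h
      linarith
    · field_simp
      linarith
  rw [key]
  constructor
  · intro h
    have hs : Real.sqrt (9 * g2 ^ 2 + 8 * g2 * μ) = 2 * g1 + 3 * g2 := by
      rw [show 9 * g2 ^ 2 + 8 * g2 * μ = (2 * g1 + 3 * g2) ^ 2 by linarith]
      exact Real.sqrt_sq (by positivity)
    have hlt : 0 < (μ - 2 * g2) * (μ + g2) := by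
      nlinarith [mul_pos h8 h1, mul_pos h8 h2, mul_pos h8 hμ]
    have hpos : 0 < μ - 2 * g2 := pos_of_mul_pos_left hlt (by positivity)
    refine ⟨g2, ⟨h2, by linarith⟩, rfl, ?_⟩
    rw [hs]
    refine ⟨?_, ?_, ?_, ?_, ?_⟩ <;> ring
  · rintro ⟨_, _, rfl, hg, _⟩
    have hs := Real.sq_sqrt (show 0 ≤ 9 * g2 ^ 2 + 8 * g2 * μ by positivity)
    rw [show Real.sqrt (9 * g2 ^ 2 + 8 * g2 * μ) = 2 * g1 + 3 * g2 by linarith] at hs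
    linarith
end

section
/- Let μ > 0 and γ₁, γ₂, γ₃, γ₇, γ₈, γ₉ > 0 satisfy γ₁ + γ₃ + γ₉ = γ₁ + γ₂ + γ₈ = γ₂ + γ₃ + γ₇ = μ and additionally γ₁γ₃ = γ₂(γ₁ + γ₃). Then the equalities −γ₁γ₃/γ₂ + γ₉ = −γ₁γ₂/γ₃ − γ₈ = −γ₂γ₃/γ₁ − γ₇ hold if and only if there exists α'' ∈ (0, μ) such that, setting β'' = (μ − 3α'' + √(μ² − 2α''μ + 5α''²))/2, one has γ₁ = α'', γ₃ = β'', γ₂ = α''β''/(α'' + β''), γ₇ = μ − (2α''β'' + β''²)/(α'' + β''), γ₈ = μ − (α''² + 2α''β'')/(α'' + β''), and γ₉ = μ − α'' − β''. -/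
/-- For `a, b > 0`, the number `b` is the larger root of `X ^ 2 + (3 * a - μ) * X + a ^ 2 - μ * a`
exactly when it is a root. -/
theorem eq_root_iff_of_pos {μ a b : ℝ} (ha : 0 < a) (hb : 0 < b) :
    b = (μ - 3 * a + Real.sqrt (μ ^ 2 - 2 * a * μ + 5 * a ^ 2)) / 2 ↔
      μ * (a + b) = (a + b) ^ 2 + a * b := by
  constructor
  · intro h
    have hs := Real.sq_sqrt (show 0 ≤ μ ^ 2 - 2 * a * μ + 5 * a ^ 2 by
      nlinarith [sq_nonneg (μ - a), sq_nonneg a])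
    rw [show Real.sqrt (μ ^ 2 - 2 * a * μ + 5 * a ^ 2) = 2 * b - μ + 3 * a by linarith] at hs
    linarith
  · intro h
    have hpos : 0 ≤ 2 * b - μ + 3 * a := by
      have hab : 0 < a * b := mul_pos ha hb
      refine nonneg_of_mul_nonneg_left (b := a + b) ?_ (add_pos ha hb)
      nlinarith [sq_nonneg a, sq_nonneg b]
    have hs : Real.sqrt (μ ^ 2 - 2 * a * μ + 5 * a ^ 2) = 2 * b - μ + 3 * a := by
      rw [← Real.sqrt_sq hpos]
      congr 1
      linarith
    rw [hs]
    ring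


/-- Case(+,−,−), branch `γ₁γ₃ = γ₂(γ₁ + γ₃)`: complete description of the one-flat-band
solution family. -/
theorem super_kagome_case_pmm_b
    (μ g1 g2 g3 g7 g8 g9 : ℝ) (hμ : 0 < μ)
    (h1 : 0 < g1) (h2 : 0 < g2) (h3 : 0 < g3)
    (h7 : 0 < g7) (h8 : 0 < g8) (h9 : 0 < g9)
    (e1 : g1 + g3 + g9 = μ) (e2 : g1 + g2 + g8 = μ) (e3 : g2 + g3 + g7 = μ)
    (hbr : g1 * g3 = g2 * (g1 + g3)) :
    (-(g1 * g3) / g2 + g9 = -(g1 * g2) / g3 - g8 ∧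
     -(g1 * g2) / g3 - g8 = -(g2 * g3) / g1 - g7)
    ↔ (∃ α'' : ℝ, α'' ∈ Set.Ioo (0 : ℝ) μ ∧
        let β'' := (μ - 3 * α'' + Real.sqrt (μ ^ 2 - 2 * α'' * μ + 5 * α'' ^ 2)) / 2
        g1 = α'' ∧
        g3 = β'' ∧
        g2 = α'' * β'' / (α'' + β'') ∧
        g7 = μ - (2 * α'' * β'' + β'' ^ 2) / (α'' + β'') ∧
        g8 = μ - (α'' ^ 2 + 2 * α'' * β'') / (α'' + β'') ∧
        g9 = μ - α'' - β'') := by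
  have hs : 0 < g1 + g3 := add_pos h1 h3
  have hg2 : g2 = g1 * g3 / (g1 + g3) := (eq_div_iff hs.ne').2 hbr.symm
  have hg7 : g7 = μ - g3 - g2 := by linarith
  have hg8 : g8 = μ - g1 - g2 := by linarith
  have hg9 : g9 = μ - g1 - g3 := by linarith
  have t1 : -(g1 * g3) / g2 + g9 = μ - 2 * (g1 + g3) := by
    rw [hg9, hbr]
    field_simp
    ring
  have t2 : -(g1 * g2) / g3 - g8 = -μ + 2 * g2 := by
    rw [hg8, hg2]
    field_simp
    ring
  have t3 : -(g2 * g3) / g1 - g7 = -μ + 2 * g2 := by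
    rw [hg7, hg2]
    field_simp
    ring
  have key : μ - 2 * (g1 + g3) = -μ + 2 * g2 ↔ μ * (g1 + g3) = (g1 + g3) ^ 2 + g1 * g3 := by
    rw [hbr]
    constructor
    · intro h
      linear_combination (g1 + g3) / 2 * h
    · intro h
      refine mul_right_cancel₀ hs.ne' ?_
      linear_combination 2 * h
  rw [t1, t2, t3, key, ← eq_root_iff_of_pos h1 h3]
  constructor
  · rintro ⟨h, -⟩
    refine ⟨g1, ⟨h1, by linarith⟩, ?_⟩
    dsimp only
    rw [← h]
    refine ⟨rfl, rfl, hg2, ?_, ?_, hg9⟩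
    · rw [hg7, hg2]
      field_simp
      ring
    · rw [hg8, hg2]
      field_simp
      ring
  · rintro ⟨_, -, rfl, h, -⟩
    exact ⟨h, rfl⟩
end
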